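/- Atkin–Lehner vanishing criterion in square-free level: Let 𝔫 ∈ A₊ be square-free and f ∈ H₀(𝔫). Suppose that for every monic divisor 𝔪 of 𝔫 with deg 𝔪 ≤ deg 𝔫 − 2, for all s, t, u, v ∈ A with s·v·𝔪² − u·t·𝔫 = 𝔪, and for every w ∈ K_∞, one has f((s𝔪, t; u𝔫, v𝔪) · (π_∞^{deg 𝔫 − deg 𝔪}, w; 0, 1)) = 0. Then f is identically zero. -/

import Mathlib

open Polynomial Matrix

noncomputable section

namespace SturmFF

variable (Fq : Type) [Field Fq] [Fintype Fq]

/-- The local field `K_∞ = 𝔽_q((π_∞))`. -/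
abbrev Kinf := LaurentSeries Fq

/-- The uniformizer `π_∞`. -/
def piInf : Kinf Fq := HahnSeries.single 1 1

/-- The element `θ = π_∞⁻¹` of `K_∞`. -/
def thetaK : Kinf Fq := HahnSeries.single (-1) 1

/-- The embedding `A = 𝔽_q[θ] → K_∞` sending `θ` to `π_∞⁻¹`. -/
def polyToK : Polynomial Fq →+* Kinf Fq := (Polynomial.aeval (thetaK Fq)).toRingHom

/-- Membership in the valuation ring `O_∞ = 𝔽_q[[π_∞]]`. -/
def memO (x : Kinf Fq) : Prop := ∀ n : ℤ, n < 0 → x.coeff n = 0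

/-- A matrix has all entries in `O_∞`. -/
def MatO (κ : Matrix (Fin 2) (Fin 2) (Kinf Fq)) : Prop := ∀ i j, memO Fq (κ i j)

/-- Membership in `GL₂(O_∞)`: entries in `O_∞` and determinant a unit of `O_∞`. -/
def InGLO (κ : Matrix (Fin 2) (Fin 2) (Kinf Fq)) : Prop :=
  MatO Fq κ ∧ κ.det.coeff 0 ≠ 0

/-- Membership in the Iwahori subgroup `I_∞ ⊆ GL₂(O_∞)`. -/
def InIw (κ : Matrix (Fin 2) (Fin 2) (Kinf Fq)) : Prop :=
  InGLO Fq κ ∧ ∀ n : ℤ, n < 1 → (κ 1 0).coeff n = 0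

/-- The matrix `diag(θ^r, 1)`. -/
def Dmat (r : ℕ) : Matrix (Fin 2) (Fin 2) (Kinf Fq) := !![thetaK Fq ^ r, 0; 0, 1]

/-- The matrix `(0, 1; π_∞, 0)`. -/
def Jmat : Matrix (Fin 2) (Fin 2) (Kinf Fq) := !![0, 1; piInf Fq, 0]

/-- The Atkin–Lehner/Fricke matrix `w_𝔫 = (0, -1; 𝔫, 0)`. -/
def wmat (𝔫 : Polynomial Fq) : Matrix (Fin 2) (Fin 2) (Kinf Fq) :=
  !![0, -1; polyToK Fq 𝔫, 0]

/-- Membership in the Hecke congruence subgroup `Γ₀(𝔫) ⊆ GL₂(A)`. -/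
def InGamma0 (𝔫 : Polynomial Fq) (γ : Matrix (Fin 2) (Fin 2) (Polynomial Fq)) : Prop :=
  IsUnit γ.det ∧ 𝔫 ∣ γ 1 0

/-- A `Γ₀(𝔫)`-invariant harmonic cochain, viewed as a function on `GL₂(K_∞)`
(encoded as a function on all matrices, with the conditions imposed on invertible ones). -/
def Harmonic (𝔫 : Polynomial Fq) (f : Matrix (Fin 2) (Fin 2) (Kinf Fq) → ℂ) : Prop :=
  (∀ g : Matrix (Fin 2) (Fin 2) (Kinf Fq), g.det ≠ 0 →
    ∀ γ : Matrix (Fin 2) (Fin 2) (Polynomial Fq), InGamma0 Fq 𝔫 γ →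
    ∀ z : Kinf Fq, z ≠ 0 → ∀ κ : Matrix (Fin 2) (Fin 2) (Kinf Fq), InIw Fq κ →
      f (γ.map (polyToK Fq) * g * (z • (1 : Matrix (Fin 2) (Fin 2) (Kinf Fq))) * κ) = f g)
  ∧ (∀ g : Matrix (Fin 2) (Fin 2) (Kinf Fq), g.det ≠ 0 → f (g * Jmat Fq) = - f g)
  ∧ (∀ g : Matrix (Fin 2) (Fin 2) (Kinf Fq), g.det ≠ 0 →
      (∑ ε : Fq, f (g * !![1, 0; polyToK Fq (Polynomial.C ε), 1])) + f (g * !![0, 1; 1, 0]) = 0)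

/-- A harmonic cochain is cuspidal if it is finitely supported modulo
`Γ₀(𝔫)` on the left and `K_∞^× I_∞` on the right. -/
def Cuspidal (𝔫 : Polynomial Fq) (f : Matrix (Fin 2) (Fin 2) (Kinf Fq) → ℂ) : Prop :=
  ∃ S : Finset (Matrix (Fin 2) (Fin 2) (Kinf Fq)),
    ∀ g : Matrix (Fin 2) (Fin 2) (Kinf Fq), g.det ≠ 0 → f g ≠ 0 →
      ∃ s ∈ S, ∃ γ : Matrix (Fin 2) (Fin 2) (Polynomial Fq), InGamma0 Fq 𝔫 γ ∧
        ∃ z : Kinf Fq, z ≠ 0 ∧ ∃ κ : Matrix (Fin 2) (Fin 2) (Kinf Fq), InIw Fq κ ∧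
          g = γ.map (polyToK Fq) * s * (z • (1 : Matrix (Fin 2) (Fin 2) (Kinf Fq))) * κ

/-- The additive character `ψ` of `K_∞`. -/
def psi (x : Kinf Fq) : ℂ :=
  letI := ZMod.algebra Fq (ringChar Fq)
  Complex.exp (2 * Real.pi * Complex.I *
    ((Algebra.trace (ZMod (ringChar Fq)) Fq (x.coeff 1)).val : ℂ) / (ringChar Fq : ℂ))

/-- The constant Fourier coefficient `c₀(f)`. -/
def c0 (f : Matrix (Fin 2) (Fin 2) (Kinf Fq) → ℂ) : ℂ :=
  (Fintype.card Fq : ℂ)⁻¹ *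
    ∑ c : Fq, f !![piInf Fq ^ 2, polyToK Fq (Polynomial.C c) * piInf Fq; 0, 1]

/-- The element `u = Σ_{i=1}^{d+1} c_i π_∞^i` of `K_∞` attached to a tuple of coefficients. -/
def uOf (d : ℕ) (c : Fin (d + 1) → Fq) : Kinf Fq :=
  ∑ i : Fin (d + 1), HahnSeries.single ((i : ℤ) + 1) (c i)

/-- The Fourier coefficient `c_𝔪(f)` for a monic polynomial `𝔪`. -/
def cm (𝔪 : Polynomial Fq) (f : Matrix (Fin 2) (Fin 2) (Kinf Fq) → ℂ) : ℂ :=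
  (Fintype.card Fq : ℂ)⁻¹ *
    ∑ c : Fin (𝔪.natDegree + 1) → Fq,
      f !![piInf Fq ^ (𝔪.natDegree + 2), uOf Fq 𝔪.natDegree c; 0, 1] *
        psi Fq (-(polyToK Fq 𝔪 * uOf Fq 𝔪.natDegree c))

/-- `δ_𝔫(c,d)`: the least `m` such that some `x, y` of degree at most `m`
satisfy `gcd(cx + dy, 𝔫) = 1`. -/
def deltaN (𝔫 c d : Polynomial Fq) : ℕ :=
  sInf { m : ℕ | ∃ x y : Polynomial Fq, x.degree ≤ (m : WithBot ℕ) ∧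
    y.degree ≤ (m : WithBot ℕ) ∧ IsCoprime (c * x + d * y) 𝔫 }

open Classical in
/-- `ε_𝔫(c,d) ∈ {0,1}`. -/
def epsN (𝔫 c d : Polynomial Fq) : ℕ :=
  if ∃ x₀ y₀ : Polynomial Fq, y₀.degree < x₀.degree ∧
      x₀.degree = (deltaN Fq 𝔫 c d : WithBot ℕ) ∧ IsCoprime (c * x₀ + d * y₀) 𝔫
  then 0 else 1

/-- The set `S(c,d;m)`. -/
def Sset (c d : Polynomial Fq) (m : ℕ) : Set (Polynomial Fq) :=
  { z | ∃ x y : Polynomial Fq, x.degree ≤ (m : WithBot ℕ) ∧ y.degree ≤ (m : WithBot ℕ) ∧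
      z = x * c + y * d }

/-- `t(c,d;m)`: the largest cardinality of a pairwise-coprime subset of `S(c,d;m)`. -/
def tcd (c d : Polynomial Fq) (m : ℕ) : ℕ :=
  sSup { n : ℕ | ∃ S' : Finset (Polynomial Fq), ↑S' ⊆ Sset Fq c d m ∧
    (∀ a ∈ S', ∀ b ∈ S', a ≠ b → IsCoprime a b) ∧ S'.card = n }

/-- `t(m,n) ∈ ℕ∞`. -/
def tmn (m n : ℕ) : ℕ∞ :=
  sInf { k : ℕ∞ | ∃ c d : Polynomial Fq, IsCoprime c d ∧
    ((m : WithBot ℕ) + 1) < max c.degree d.degree ∧ max c.degree d.degree < (n : WithBot ℕ) ∧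
    k = (tcd Fq c d m : ℕ∞) }

/-- `t(𝔫)`: the number of distinct monic prime factors of `𝔫`. -/
def tPrimes (𝔫 : Polynomial Fq) : ℕ :=
  Set.ncard { p : Polynomial Fq | p.Monic ∧ Irreducible p ∧ p ∣ 𝔫 }

/-- `τ(𝔫)`. -/
def tauN (𝔫 : Polynomial Fq) : ℕ :=
  sInf { m : ℕ | (tPrimes Fq 𝔫 : ℕ∞) < tmn Fq m 𝔫.natDegree }

variable {Fq}

set_option linter.unusedSectionVars false

section Valuation

variable {R : Type} [Field R]

/-- `x` has valuation at least `n`. -/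
def VGe (n : ℤ) (x : LaurentSeries R) : Prop := ∀ m : ℤ, m < n → x.coeff m = 0

theorem vGe_iff_le_orderTop {n : ℤ} {x : LaurentSeries R} :
    VGe n x ↔ (n : WithTop ℤ) ≤ x.orderTop := by
  rw [HahnSeries.le_orderTop_iff_forall]
  simp [VGe]

theorem vGe_iff_le_order {n : ℤ} {x : LaurentSeries R} (hx : x ≠ 0) :
    VGe n x ↔ n ≤ x.order := by
  rw [HahnSeries.le_order_iff_forall hx]
  rfl

theorem vGe_zero (n : ℤ) : VGe n (0 : LaurentSeries R) := fun _ _ => rfl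

theorem VGe.mono {a b : ℤ} {x : LaurentSeries R} (h : VGe b x) (hab : a ≤ b) : VGe a x :=
  fun m hm => h m (hm.trans_le hab)

theorem VGe.mul {a b : ℤ} {x y : LaurentSeries R} (hx : VGe a x) (hy : VGe b y) :
    VGe (a + b) (x * y) := by
  rw [vGe_iff_le_orderTop] at *
  rw [HahnSeries.orderTop_mul]
  exact_mod_cast add_le_add hx hy

theorem vGe_of_mul {a b : ℤ} {x y : LaurentSeries R} (hx : x ≠ 0) (hxo : x.order ≤ b)
    (h : VGe (a + b) (x * y)) : VGe a y := by
  rcases eq_or_ne y 0 with rfl | hy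
  · exact vGe_zero _
  rw [vGe_iff_le_order (mul_ne_zero hx hy), HahnSeries.order_mul hx hy] at h
  rw [vGe_iff_le_order hy]
  omega

theorem vGe_single (n : ℤ) (r : R) : VGe n (HahnSeries.single n r : LaurentSeries R) :=
  fun m hm => by rw [HahnSeries.coeff_single_of_ne hm.ne]

theorem order_inv {x : LaurentSeries R} (hx : x ≠ 0) : (x⁻¹).order = -x.order := by
  have h := HahnSeries.order_mul hx (inv_ne_zero hx)
  rw [mul_inv_cancel₀ hx, HahnSeries.order_one] at h
  omega

theorem coeff_zero_ne_zero_of_order {x : LaurentSeries R} (hx : x ≠ 0) (h : x.order = 0) :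
    x.coeff 0 ≠ 0 := by
  have := HahnSeries.coeff_order_eq_zero.not.mpr hx
  rwa [h] at this

end Valuation

theorem piInf_zpow (k : ℤ) : piInf Fq ^ k = HahnSeries.single k 1 :=
  (RatFunc.single_zpow k).symm

theorem piInf_ne_zero : piInf Fq ≠ 0 := by simp [piInf]

theorem order_piInf_zpow (k : ℤ) : (piInf Fq ^ k).order = k := by
  rw [piInf_zpow, HahnSeries.order_single one_ne_zero]

theorem vGe_piInf_zpow (k : ℤ) : VGe k (piInf Fq ^ k) := by
  rw [piInf_zpow]; exact vGe_single _ _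

theorem polyToK_C (a : Fq) : polyToK Fq (C a) = HahnSeries.single 0 a := by
  simp only [polyToK, AlgHom.toRingHom_eq_coe, RingHom.coe_coe, aeval_C]
  rw [HahnSeries.algebraMap_apply']
  simp

theorem polyToK_X_pow (n : ℕ) : polyToK Fq (X ^ n) = HahnSeries.single (-(n : ℤ)) 1 := by
  simp [polyToK, thetaK, HahnSeries.single_pow]

theorem coeff_polyToK (p : Polynomial Fq) (j : ℤ) :
    (polyToK Fq p).coeff j = if j ≤ 0 then p.coeff (-j).toNat else 0 := by
  induction p using Polynomial.induction_on' with
  | add p q hp hq => rw [map_add, HahnSeries.coeff_add, hp, hq]; split_ifs <;> simp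
  | monomial n a =>
    rw [← C_mul_X_pow_eq_monomial, map_mul, polyToK_C, polyToK_X_pow,
      HahnSeries.single_mul_single, HahnSeries.coeff_single, coeff_C_mul_X_pow, zero_add, mul_one]
    split_ifs <;> first | rfl | omega

theorem polyToK_ne_zero {p : Polynomial Fq} (hp : p ≠ 0) : polyToK Fq p ≠ 0 := by
  intro h
  have := coeff_polyToK p (-p.natDegree)
  simp [h] at this
  exact hp (leadingCoeff_eq_zero.mp this.symm)

theorem order_polyToK {p : Polynomial Fq} (hp : p ≠ 0) :
    (polyToK Fq p).order = -(p.natDegree : ℤ) := by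
  apply le_antisymm
  · apply HahnSeries.order_le_of_coeff_ne_zero
    rw [coeff_polyToK]
    simpa using hp
  · rw [← vGe_iff_le_order (polyToK_ne_zero hp)]
    intro m hm
    rw [coeff_polyToK, if_pos (by omega)]
    exact coeff_eq_zero_of_natDegree_lt (by omega)

/-- Every element of `K_∞` is congruent to a polynomial modulo `π_∞ O_∞`. -/
theorem exists_vGe_sub_polyToK (x : Kinf Fq) : ∃ a : Polynomial Fq, VGe 1 (x - polyToK Fq a) := by
  refine ⟨∑ i ∈ Finset.range ((-x.order).toNat + 1), C (x.coeff (-(i : ℤ))) * X ^ i, ?_⟩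
  intro m hm
  rw [HahnSeries.coeff_sub, coeff_polyToK, if_pos (by omega)]
  simp only [finsetSum_coeff, coeff_C_mul_X_pow, Finset.sum_ite_eq, Finset.mem_range]
  split_ifs with h
  · rw [show -(((-m).toNat : ℕ) : ℤ) = m by omega, sub_self]
  · rw [sub_zero]
    exact HahnSeries.coeff_eq_zero_of_lt_order (by omega)

/-- Dirichlet's approximation theorem in `K_∞`. -/
theorem exists_polyToK_mul_add_vGe (x : Kinf Fq) (l : ℕ) :
    ∃ c : Polynomial Fq, c ≠ 0 ∧ c.natDegree ≤ l ∧
      ∃ s : Polynomial Fq, VGe (l + 1) (polyToK Fq c * x + polyToK Fq s) := by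
  let T : Polynomial.degreeLT Fq (l + 1) →ₗ[Fq] (Fin l → Fq) :=
    { toFun := fun c i => (polyToK Fq c * x).coeff ((i : ℤ) + 1)
      map_add' := fun c d => by ext i; simp [add_mul]
      map_smul' := fun a c => by
        ext i
        simp only [SetLike.val_smul, Polynomial.smul_eq_C_mul, map_mul, polyToK_C, mul_assoc,
          HahnSeries.coeff_single_zero_mul, RingHom.id_apply, Pi.smul_apply, smul_eq_mul] }
  have hT : LinearMap.ker T ≠ ⊥ := by
    apply LinearMap.ker_ne_bot_of_finrank_lt
    rw [(Polynomial.degreeLTEquiv Fq (l + 1)).finrank_eq]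
    simp
  obtain ⟨⟨c, hc⟩, hcT, hc0⟩ := Submodule.exists_mem_ne_zero_of_ne_bot hT
  have hc0' : c ≠ 0 := fun h => hc0 (Subtype.ext h)
  obtain ⟨a, ha⟩ := exists_vGe_sub_polyToK (polyToK Fq c * x)
  refine ⟨c, hc0', ?_, -a, ?_⟩
  · rw [Polynomial.mem_degreeLT, Polynomial.degree_eq_natDegree hc0'] at hc
    have : c.natDegree < l + 1 := by exact_mod_cast hc
    omega
  · rw [map_neg, ← sub_eq_add_neg]
    intro m hm
    by_cases h1 : m < 1
    · exact ha m h1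
    · have := congrFun (LinearMap.mem_ker.mp hcT) ⟨(m - 1).toNat, by omega⟩
      have hm' : (((m - 1).toNat : ℕ) : ℤ) + 1 = m := by omega
      simp only [T, LinearMap.coe_mk, AddHom.coe_mk, Pi.zero_apply, hm'] at this
      rw [HahnSeries.coeff_sub, coeff_polyToK, if_neg (by omega), this, sub_zero]

/-- The matrix `(π_∞^k, w; 0, 1)`. -/
def edge (k : ℤ) (w : Kinf Fq) : Matrix (Fin 2) (Fin 2) (Kinf Fq) := !![piInf Fq ^ k, w; 0, 1]

theorem det_edge (k : ℤ) (w : Kinf Fq) : (edge k w).det = piInf Fq ^ k := by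
  simp [edge, Matrix.det_fin_two_of]

theorem det_edge_ne_zero (k : ℤ) (w : Kinf Fq) : (edge k w).det ≠ 0 := by
  rw [det_edge]; exact zpow_ne_zero _ piInf_ne_zero

theorem inIw_of {a b c d : Kinf Fq} (ha : VGe 0 a) (hb : VGe 0 b) (hc : VGe 1 c) (hd : VGe 0 d)
    (hdet : (a * d - b * c).coeff 0 ≠ 0) : InIw Fq !![a, b; c, d] := by
  refine ⟨⟨?_, by rwa [Matrix.det_fin_two_of]⟩, hc⟩
  intro i j
  fin_cases i <;> fin_cases j
  exacts [ha, hb, hc.mono zero_le_one, hd]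

/-- The conditions on a harmonic cochain that only involve multiplication on the right. -/
structure RightHarmonic (F : Matrix (Fin 2) (Fin 2) (Kinf Fq) → ℂ) : Prop where
  mul_iw : ∀ g, g.det ≠ 0 → ∀ z : Kinf Fq, z ≠ 0 → ∀ κ, InIw Fq κ →
    F (g * (z • (1 : Matrix (Fin 2) (Fin 2) (Kinf Fq))) * κ) = F g
  mul_J : ∀ g, g.det ≠ 0 → F (g * Jmat Fq) = -F g
  sum_star : ∀ g, g.det ≠ 0 →
    (∑ ε : Fq, F (g * !![1, 0; polyToK Fq (C ε), 1])) + F (g * !![0, 1; 1, 0]) = 0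

theorem inGamma0_one (𝔫 : Polynomial Fq) : InGamma0 Fq 𝔫 1 := by
  simp [InGamma0]

theorem Harmonic.rightHarmonic {𝔫 : Polynomial Fq} {f : Matrix (Fin 2) (Fin 2) (Kinf Fq) → ℂ}
    (hf : Harmonic Fq 𝔫 f) {W : Matrix (Fin 2) (Fin 2) (Kinf Fq)} (hW : W.det ≠ 0) :
    RightHarmonic (fun g => f (W * g)) where
  mul_iw g hg z hz κ hκ := by
    have hWg : (W * g).det ≠ 0 := by rw [Matrix.det_mul]; exact mul_ne_zero hW hg
    have := hf.1 (W * g) hWg 1 (inGamma0_one 𝔫) z hz κ hκ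
    rw [Matrix.map_one _ (map_zero _) (map_one _), Matrix.one_mul] at this
    simpa only [Matrix.mul_assoc] using this
  mul_J g hg := by
    have hWg : (W * g).det ≠ 0 := by rw [Matrix.det_mul]; exact mul_ne_zero hW hg
    simpa only [Matrix.mul_assoc] using hf.2.1 (W * g) hWg
  sum_star g hg := by
    have hWg : (W * g).det ≠ 0 := by rw [Matrix.det_mul]; exact mul_ne_zero hW hg
    simpa only [Matrix.mul_assoc] using hf.2.2 (W * g) hWg

namespace RightHarmonic

variable {F : Matrix (Fin 2) (Fin 2) (Kinf Fq) → ℂ}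

theorem mul_iw' (hF : RightHarmonic F) {g κ : Matrix (Fin 2) (Fin 2) (Kinf Fq)} (hg : g.det ≠ 0)
    (hκ : InIw Fq κ) : F (g * κ) = F g := by
  simpa using hF.mul_iw g hg 1 one_ne_zero κ hκ

/-- The value on an edge is the sum of the values on its `q` predecessors. -/
theorem edge_eq_sum (hF : RightHarmonic F) (k : ℤ) (w : Kinf Fq) :
    F (edge k w) = ∑ a : Fq, F (edge (k + 1) (w + polyToK Fq (C a) * piInf Fq ^ k)) := by
  classical
  set b : Fq → ℂ := fun a => F (edge (k + 1) (w + polyToK Fq (C a) * piInf Fq ^ k)) with hb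
  have hdet := det_edge_ne_zero (Fq := Fq) k w
  have hpi : piInf Fq ^ (k + 1) = piInf Fq ^ k * piInf Fq := zpow_add_one₀ piInf_ne_zero k
  have h0 : F (edge k w * !![1, 0; polyToK Fq (C 0), 1]) = F (edge k w) := by
    simp [← Matrix.one_fin_two]
  have hlast : F (edge k w * !![0, 1; 1, 0]) = -b 0 := by
    have h1 := hF.mul_J (edge k w * !![0, 1; 1, 0]) (by
      rw [Matrix.det_mul]; exact mul_ne_zero hdet (by simp [Matrix.det_fin_two_of]))
    have h2 : edge k w * !![0, 1; 1, 0] * Jmat Fq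
        = edge (k + 1) (w + polyToK Fq (C 0) * piInf Fq ^ k) := by
      simp [edge, Jmat, hpi]
    rw [h2] at h1
    rw [hb]; linear_combination h1
  have hne : ∀ ε : Fq, ε ≠ 0 →
      F (edge k w * !![1, 0; polyToK Fq (C ε), 1]) = -b ε⁻¹ := by
    intro ε hε
    have hεε : polyToK Fq (C ε⁻¹) * polyToK Fq (C ε) = 1 := by
      rw [← map_mul, ← C_mul, inv_mul_cancel₀ hε, C_1, map_one]
    have h1 := hF.mul_J (edge k w * !![1, 0; polyToK Fq (C ε), 1]) (by
      rw [Matrix.det_mul]; exact mul_ne_zero hdet (by simp [Matrix.det_fin_two_of]))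
    have h2 : edge k w * !![1, 0; polyToK Fq (C ε), 1] * Jmat Fq
        = edge (k + 1) (w + polyToK Fq (C ε⁻¹) * piInf Fq ^ k)
          * !![-polyToK Fq (C ε⁻¹), 0; piInf Fq, polyToK Fq (C ε)] := by
      refine Matrix.ext fun i j => ?_
      fin_cases i <;> fin_cases j <;>
        simp [edge, Jmat, hpi, -map_inv₀]
      · ring
      · linear_combination -(piInf Fq ^ k) * hεε
    have hκ : InIw Fq !![-polyToK Fq (C ε⁻¹), 0; piInf Fq, polyToK Fq (C ε)] := by
      apply inIw_of
      · rw [← map_neg, ← C_neg, polyToK_C]; exact vGe_single _ _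
      · exact vGe_zero _
      · exact vGe_single _ _
      · rw [polyToK_C]; exact vGe_single _ _
      · rw [neg_mul, hεε]; simp
    rw [h2, hF.mul_iw' (det_edge_ne_zero _ _) hκ] at h1
    rw [hb]; linear_combination h1
  have hs := hF.sum_star (edge k w) hdet
  rw [hlast, ← Finset.add_sum_erase _ _ (Finset.mem_univ (0 : Fq)), h0,
    Finset.sum_congr rfl (fun ε hε => hne ε (Finset.ne_of_mem_erase hε)),
    Finset.sum_neg_distrib] at hs
  have hinv : ∑ a : Fq, b a = ∑ a : Fq, b a⁻¹ :=
    (Equiv.sum_comp (Equiv.inv Fq) b).symm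
  rw [hinv, ← Finset.add_sum_erase _ _ (Finset.mem_univ (0 : Fq)), _root_.inv_zero]
  linear_combination hs

/-- Vanishing on all edges of a given depth propagates to smaller depths. -/
theorem edge_eq_zero_of_le (hF : RightHarmonic F) {K : ℤ} (hK : ∀ w, F (edge K w) = 0) (k : ℤ)
    (hk : k ≤ K) (w : Kinf Fq) : F (edge k w) = 0 := by
  induction k, hk using Int.leInductionDown generalizing w with
  | base => exact hK w
  | pred k _ ih =>
    rw [hF.edge_eq_sum]
    exact Finset.sum_eq_zero fun a _ => by rw [sub_add_cancel]; exact ih _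

/-- If `F` vanishes on the edges of depth at most `K`, then it vanishes on every `g` which lies
deep enough in the corresponding horoball and points towards the cusp at infinity. -/
theorem eq_zero_of_lower (hF : RightHarmonic F) {K : ℤ} (hK : ∀ k ≤ K, ∀ w, F (edge k w) = 0)
    {g : Matrix (Fin 2) (Fin 2) (Kinf Fq)} (hg : g.det ≠ 0) (h11 : g 1 1 ≠ 0)
    (h10 : VGe 1 (g 1 0 / g 1 1)) (hle : g.det.order ≤ K + 2 * (g 1 1).order) : F g = 0 := by
  set k : ℤ := g.det.order - 2 * (g 1 1).order with hk
  have hπ : piInf Fq ^ k ≠ 0 := zpow_ne_zero _ piInf_ne_zero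
  set e : Kinf Fq := g.det / (g 1 1 ^ 2 * piInf Fq ^ k) with he
  have hz : g 1 1 ^ 2 * piInf Fq ^ k ≠ 0 := mul_ne_zero (pow_ne_zero _ h11) hπ
  have he0 : e ≠ 0 := div_ne_zero hg hz
  have hord : e.order = 0 := by
    have h1 : e * (g 1 1 * g 1 1 * piInf Fq ^ k) = g.det := by
      rw [he]; field_simp
    have h2 := congrArg HahnSeries.order h1
    rw [HahnSeries.order_mul he0 (mul_ne_zero (mul_ne_zero h11 h11) hπ),
      HahnSeries.order_mul (mul_ne_zero h11 h11) hπ, HahnSeries.order_mul h11 h11,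
      order_piInf_zpow] at h2
    omega
  have hκ : InIw Fq !![e, 0; g 1 0 / g 1 1, 1] := by
    apply inIw_of
    · exact (vGe_iff_le_order he0).mpr hord.ge
    · exact vGe_zero _
    · exact h10
    · exact vGe_single 0 1
    · simpa using coeff_zero_ne_zero_of_order he0 hord
  have hdec : g = edge k (g 0 1 / g 1 1) *
      (g 1 1 • (1 : Matrix (Fin 2) (Fin 2) (Kinf Fq))) * !![e, 0; g 1 0 / g 1 1, 1] := by
    have h00 : g 1 1 * piInf Fq ^ k * e + g 1 1 * (g 0 1 / g 1 1) * (g 1 0 / g 1 1) = g 0 0 := by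
      rw [he, Matrix.det_fin_two]; field_simp; ring
    refine Matrix.ext fun i j => ?_
    fin_cases i <;> fin_cases j
    · simpa [edge, Matrix.mul_apply, Fin.sum_univ_two] using h00.symm
    all_goals simp [edge, Matrix.mul_apply, Fin.sum_univ_two, mul_div_cancel₀ _ h11]
  rw [hdec, hF.mul_iw _ (det_edge_ne_zero _ _) _ h11 _ hκ]
  exact hK k (by omega) _

theorem eq_zero_of_vGe (hF : RightHarmonic F) {K : ℤ} (hK : ∀ k ≤ K, ∀ w, F (edge k w) = 0)
    {g : Matrix (Fin 2) (Fin 2) (Kinf Fq)} (hg : g.det ≠ 0) {a b : ℤ}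
    (ha : VGe a (g 1 1)) (hb : VGe b (g 1 0))
    (hda : g.det.order ≤ K + 2 * a) (hdb : g.det.order + 1 ≤ K + 2 * b) : F g = 0 := by
  by_cases hcase : g 1 1 ≠ 0 ∧ VGe 1 (g 1 0 / g 1 1)
  · refine hF.eq_zero_of_lower hK hg hcase.1 hcase.2 ?_
    rw [vGe_iff_le_order hcase.1] at ha
    omega
  · have h10 : g 1 0 ≠ 0 := by
      intro h0
      apply hcase
      refine ⟨fun h1 => hg ?_, by rw [h0, zero_div]; exact vGe_zero _⟩
      rw [Matrix.det_fin_two, h0, h1]; ring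
    have hdetJ : (g * Jmat Fq).det = g.det * (-piInf Fq) := by
      rw [Matrix.det_mul]; simp [Jmat, Matrix.det_fin_two_of]
    have hπ := order_piInf_zpow (Fq := Fq) 1
    rw [zpow_one] at hπ
    have hJ11 : (g * Jmat Fq) 1 1 = g 1 0 := by simp [Jmat, Matrix.mul_apply, Fin.sum_univ_two]
    have hJ10 : (g * Jmat Fq) 1 0 = g 1 1 * piInf Fq := by
      simp [Jmat, Matrix.mul_apply, Fin.sum_univ_two]
    have hJ : F (g * Jmat Fq) = 0 := by
      have hdet0 : (g * Jmat Fq).det ≠ 0 := by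
        rw [hdetJ]; exact mul_ne_zero hg (neg_ne_zero.mpr piInf_ne_zero)
      refine hF.eq_zero_of_lower hK hdet0 (by rwa [hJ11]) ?_ ?_
      · rw [hJ10, hJ11]
        by_cases h11 : g 1 1 = 0
        · rw [h11, zero_mul, zero_div]; exact vGe_zero _
        have hlt : ¬VGe 1 (g 1 0 / g 1 1) := fun h => hcase ⟨h11, h⟩
        rw [div_eq_mul_inv, vGe_iff_le_order (mul_ne_zero h10 (inv_ne_zero h11)),
          HahnSeries.order_mul h10 (inv_ne_zero h11), order_inv h11] at hlt
        rw [div_eq_mul_inv, vGe_iff_le_order (mul_ne_zero (mul_ne_zero h11 piInf_ne_zero)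
          (inv_ne_zero h10)), HahnSeries.order_mul (mul_ne_zero h11 piInf_ne_zero)
          (inv_ne_zero h10), HahnSeries.order_mul h11 piInf_ne_zero, order_inv h10, hπ]
        omega
      · rw [hJ11, hdetJ, HahnSeries.order_mul hg (neg_ne_zero.mpr piInf_ne_zero),
          HahnSeries.order_neg, hπ]
        rw [vGe_iff_le_order h10] at hb
        omega
    have := hF.mul_J g hg
    rw [hJ] at this
    exact neg_eq_zero.mp this.symm

end RightHarmonic

theorem det_map_polyToK (M : Matrix (Fin 2) (Fin 2) (Polynomial Fq)) :
    (M.map (polyToK Fq)).det = polyToK Fq M.det :=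
  ((polyToK Fq).map_det M).symm

/-- A cuspidal harmonic cochain takes only finitely many values. -/
theorem Cuspidal.finite_values {𝔫 : Polynomial Fq} {f : Matrix (Fin 2) (Fin 2) (Kinf Fq) → ℂ}
    (hf : Harmonic Fq 𝔫 f) (hcusp : Cuspidal Fq 𝔫 f) : (f '' {g | g.det ≠ 0}).Finite := by
  obtain ⟨S, hS⟩ := hcusp
  refine ((S.finite_toSet.image f).insert 0).subset ?_
  rintro _ ⟨g, hg, rfl⟩
  rcases eq_or_ne (f g) 0 with h0 | h0
  · exact Or.inl h0
  right
  obtain ⟨s, hs, γ, hγ, z, hz, κ, hκ, rfl⟩ := hS g hg h0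
  refine ⟨s, hs, (hf.1 s ?_ γ hγ z hz κ hκ).symm⟩
  intro hs0
  apply hg
  simp [Matrix.det_mul, hs0]

/-- A harmonic cochain with finitely many values which is invariant under translation by `A`
vanishes near the cusp at infinity. -/
theorem RightHarmonic.edge_eq_zero_of_finite {F : Matrix (Fin 2) (Fin 2) (Kinf Fq) → ℂ}
    (hF : RightHarmonic F)
    (htrans : ∀ (a : Polynomial Fq) g, g.det ≠ 0 → F (!![1, polyToK Fq a; 0, 1] * g) = F g)
    (hfin : (F '' {g | g.det ≠ 0}).Finite) (k : ℤ) (hk : k ≤ 1) (w : Kinf Fq) :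
    F (edge k w) = 0 := by
  have hone : ∀ w, F (edge 1 w) = F (edge 1 0) := by
    intro w
    obtain ⟨a, ha⟩ := exists_vGe_sub_polyToK w
    have hπ : piInf Fq * ((w - polyToK Fq a) * (piInf Fq)⁻¹) = w - polyToK Fq a := by
      field_simp [piInf_ne_zero]
    have hdec : edge 1 w = !![1, polyToK Fq a; 0, 1] *
        (edge 1 0 * !![1, (w - polyToK Fq a) * (piInf Fq)⁻¹; 0, 1]) := by
      refine Matrix.ext fun i j => ?_
      fin_cases i <;> fin_cases j
      · simp [edge]
      · simp only [edge, Matrix.mul_apply, Fin.sum_univ_two]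
        simp [hπ]
      all_goals simp [edge]
    have hκ : InIw Fq !![1, (w - polyToK Fq a) * (piInf Fq)⁻¹; 0, 1] := by
      apply inIw_of
      · exact vGe_single 0 1
      · simpa using ha.mul (vGe_piInf_zpow (Fq := Fq) (-1))
      · exact vGe_zero _
      · exact vGe_single 0 1
      · simp
    rw [hdec, htrans, hF.mul_iw' (det_edge_ne_zero _ _) hκ]
    rw [Matrix.det_mul]
    exact mul_ne_zero (det_edge_ne_zero _ _) (by simp [Matrix.det_fin_two_of])
  have hpow : ∀ (i : ℕ) (w : Kinf Fq),
      F (edge (1 - i) w) = (Fintype.card Fq : ℂ) ^ i * F (edge 1 0) := by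
    intro i
    induction i with
    | zero => intro w; simpa using hone w
    | succ i ih =>
      intro w
      rw [hF.edge_eq_sum, show (1 : ℤ) - ((i + 1 : ℕ) : ℤ) + 1 = 1 - i by push_cast; ring]
      simp only [ih, Finset.sum_const, Finset.card_univ, nsmul_eq_mul]
      ring
  have hzero : F (edge 1 0) = 0 := by
    by_contra hne
    refine Set.infinite_of_injective_forall_mem (f := fun i : ℕ => F (edge (1 - i) 0)) ?_ ?_ hfin
    · intro i j hij
      simp only [hpow] at hij
      have h1 := mul_right_cancel₀ hne hij
      exact Nat.pow_right_injective (Fintype.one_lt_card (α := Fq)) (by exact_mod_cast h1)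
    · exact fun i => ⟨_, det_edge_ne_zero _ _, rfl⟩
  exact hF.edge_eq_zero_of_le (fun w => (hone w).trans hzero) k hk w

/-- For coprime `c, a` there is an Atkin–Lehner matrix of square-free level `𝔫` sending `∞` to the
cusp annihilated by the row vector `(c, a)`. -/
theorem exists_atkinLehner {R : Type} [Field R] {𝔫 c a : Polynomial R} (h𝔫 : 𝔫.Monic)
    (hsf : Squarefree 𝔫) (hca : IsCoprime c a) :
    ∃ 𝔪 𝔫' s t u v : Polynomial R, 𝔪.Monic ∧ 𝔫 = 𝔫' * 𝔪 ∧ IsCoprime 𝔪 c ∧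
      s * v * 𝔪 ^ 2 - u * t * 𝔫 = 𝔪 ∧ c = -(u * 𝔫') ∧ a = s := by
  classical
  have h0 : EuclideanDomain.gcd c 𝔫 ≠ 0 := fun h =>
    h𝔫.ne_zero (EuclideanDomain.gcd_eq_zero_iff.mp h).2
  set d := EuclideanDomain.gcd c 𝔫 with hd
  obtain ⟨𝔫', h𝔫', hassoc⟩ : ∃ 𝔫' : Polynomial R, 𝔫'.Monic ∧ Associated d 𝔫' :=
    ⟨d * C d.leadingCoeff⁻¹, Polynomial.monic_mul_leadingCoeff_inv h0,
      associated_mul_unit_right _ _ (isUnit_C.mpr (by simpa using h0))⟩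
  obtain ⟨e, he⟩ : 𝔫' ∣ c := hassoc.dvd_iff_dvd_left.mp (EuclideanDomain.gcd_dvd_left c 𝔫)
  obtain ⟨𝔪, hm⟩ : 𝔫' ∣ 𝔫 := hassoc.dvd_iff_dvd_left.mp (EuclideanDomain.gcd_dvd_right c 𝔫)
  have hnm : IsCoprime 𝔫' 𝔪 := by
    rw [hm, squarefree_mul_iff] at hsf
    exact hsf.1.isCoprime
  have hmc : IsCoprime 𝔪 c := by
    rw [← isRelPrime_iff_isCoprime]
    intro x hxm hxc
    have hxd : x ∣ 𝔫' := hassoc.dvd_iff_dvd_right.mp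
      (EuclideanDomain.dvd_gcd hxc (hxm.trans ⟨𝔫', by rw [hm, mul_comm]⟩))
    exact hnm.isRelPrime hxd hxm
  obtain ⟨α, β, hαβ⟩ : IsCoprime (a * 𝔪) c := hca.symm.mul_left hmc
  refine ⟨𝔪, 𝔫', a, β, -e, α, ?_, hm, hmc, ?_, by rw [he]; ring, rfl⟩
  · rw [hm] at h𝔫; exact h𝔫'.of_mul_monic_left h𝔫
  · rw [hm]
    rw [he] at hαβ
    linear_combination 𝔪 * hαβ

/-- A short vector in the lattice of row vectors `(c, s)` with `𝔫 ∣ c`. -/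
theorem exists_short_vector {𝔫 : Polynomial Fq} (h𝔫 : 𝔫.Monic) (k : ℤ) (w : Kinf Fq) :
    ∃ c s : Polynomial Fq, 𝔫 ∣ c ∧ (c ≠ 0 ∨ s ≠ 0) ∧ ∃ α β : ℤ,
      VGe α (polyToK Fq c * piInf Fq ^ k) ∧ VGe β (polyToK Fq c * w + polyToK Fq s) ∧
      k + 1 ≤ 𝔫.natDegree + 2 * α ∧ k ≤ 𝔫.natDegree + 2 * β := by
  rcases le_or_gt k 𝔫.natDegree with hk | hk
  · refine ⟨0, 1, dvd_zero _, Or.inr one_ne_zero, k.toNat + 1, 0, ?_, ?_, by omega, by omega⟩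
    · rw [map_zero, zero_mul]; exact vGe_zero _
    · rw [map_zero, zero_mul, zero_add, map_one]; exact vGe_single 0 1
  · obtain ⟨l, hl⟩ : ∃ l : ℕ, (l : ℤ) = (k - 𝔫.natDegree - 1) / 2 :=
      ⟨((k - 𝔫.natDegree - 1) / 2).toNat, by omega⟩
    obtain ⟨c, hc0, hcl, s, hs⟩ := exists_polyToK_mul_add_vGe (polyToK Fq 𝔫 * w) l
    have hnc : 𝔫 * c ≠ 0 := mul_ne_zero h𝔫.ne_zero hc0
    refine ⟨𝔫 * c, s, dvd_mul_right _ _, Or.inl hnc,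
      -((𝔫 * c).natDegree : ℤ) + k, l + 1, ?_, ?_, ?_, by omega⟩
    · exact ((vGe_iff_le_order (polyToK_ne_zero hnc)).mpr (order_polyToK hnc).ge).mul
        (vGe_piInf_zpow k)
    · have : polyToK Fq (𝔫 * c) * w = polyToK Fq c * (polyToK Fq 𝔫 * w) := by
        rw [map_mul]; ring
      rwa [this]
    · rw [Polynomial.natDegree_mul h𝔫.ne_zero hc0]
      omega

theorem inIw_one : InIw Fq 1 := by
  rw [Matrix.one_fin_two]
  exact inIw_of (vGe_single 0 1) (vGe_zero _) (vGe_zero _) (vGe_single 0 1) (by simp)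

theorem RightHarmonic.smul {F : Matrix (Fin 2) (Fin 2) (Kinf Fq) → ℂ} (hF : RightHarmonic F)
    {g : Matrix (Fin 2) (Fin 2) (Kinf Fq)} (hg : g.det ≠ 0) {z : Kinf Fq} (hz : z ≠ 0) :
    F (z • g) = F g := by
  simpa using hF.mul_iw g hg z hz 1 inIw_one

theorem Harmonic.rightHarmonic_self {𝔫 : Polynomial Fq}
    {f : Matrix (Fin 2) (Fin 2) (Kinf Fq) → ℂ} (hf : Harmonic Fq 𝔫 f) : RightHarmonic f := by
  simpa using hf.rightHarmonic (W := 1) (by simp)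

/-- A harmonic cochain which vanishes on all edges `(π_∞^k, w; 0, 1)` is zero. -/
theorem RightHarmonic.eq_zero_of_edge {F : Matrix (Fin 2) (Fin 2) (Kinf Fq) → ℂ}
    (hF : RightHarmonic F) (h : ∀ k w, F (edge k w) = 0)
    {g : Matrix (Fin 2) (Fin 2) (Kinf Fq)} (hg : g.det ≠ 0) : F g = 0 := by
  obtain ⟨a, ha⟩ : ∃ a : ℤ, VGe a (g 1 1) :=
    ⟨_, fun m hm => HahnSeries.coeff_eq_zero_of_lt_order hm⟩
  obtain ⟨b, hb⟩ : ∃ b : ℤ, VGe b (g 1 0) :=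
    ⟨_, fun m hm => HahnSeries.coeff_eq_zero_of_lt_order hm⟩
  exact hF.eq_zero_of_vGe (K := max (g.det.order - 2 * a) (g.det.order + 1 - 2 * b))
    (fun k _ w => h k w) hg ha hb (by omega) (by omega)

section AtkinLehner

variable {𝔫 𝔪 s t u v : Polynomial Fq} {f : Matrix (Fin 2) (Fin 2) (Kinf Fq) → ℂ}

theorem det_atkinLehner (hdet : s * v * 𝔪 ^ 2 - u * t * 𝔫 = 𝔪) :
    ((!![s * 𝔪, t; u * 𝔫, v * 𝔪]).map (polyToK Fq)).det = polyToK Fq 𝔪 := by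
  rw [det_map_polyToK, Matrix.det_fin_two_of]
  congr 1
  linear_combination hdet

/-- An Atkin–Lehner transform of a harmonic cochain is invariant under translation by `A`. -/
theorem Harmonic.atkinLehner_translate (hf : Harmonic Fq 𝔫 f) (h𝔪 : 𝔪 ≠ 0) (hdvd : 𝔪 ∣ 𝔫)
    (hdet : s * v * 𝔪 ^ 2 - u * t * 𝔫 = 𝔪) (a : Polynomial Fq)
    {g : Matrix (Fin 2) (Fin 2) (Kinf Fq)} (hg : g.det ≠ 0) :
    f ((!![s * 𝔪, t; u * 𝔫, v * 𝔪]).map (polyToK Fq) * (!![1, polyToK Fq a; 0, 1] * g)) =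
      f ((!![s * 𝔪, t; u * 𝔫, v * 𝔪]).map (polyToK Fq) * g) := by
  obtain ⟨𝔫', rfl⟩ := hdvd
  have hdet' : s * v * 𝔪 - u * t * 𝔫' = 1 := by
    apply mul_left_cancel₀ h𝔪
    linear_combination hdet
  set γ : Matrix (Fin 2) (Fin 2) (Polynomial Fq) :=
    !![1 - a * s * u * (𝔪 * 𝔫'), a * s ^ 2 * 𝔪;
      -(a * u ^ 2 * 𝔫' * (𝔪 * 𝔫')), 1 + a * s * u * (𝔪 * 𝔫')] with hγdef
  have hγ : InGamma0 Fq (𝔪 * 𝔫') γ := by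
    refine ⟨?_, ?_⟩
    · rw [hγdef, Matrix.det_fin_two_of]
      convert isUnit_one using 1
      ring
    · exact ⟨-(a * u ^ 2 * 𝔫'), by simp [γ]; ring⟩
  have hmul : (!![s * 𝔪, t; u * (𝔪 * 𝔫'), v * 𝔪]) * !![1, a; 0, 1] =
      γ * !![s * 𝔪, t; u * (𝔪 * 𝔫'), v * 𝔪] := by
    rw [hγdef, Matrix.mul_fin_two, Matrix.mul_fin_two]
    congr! 3
    · ring
    · congr! 1
      linear_combination (-a * s * 𝔪) * hdet'
    · congr! 1
      · ring
      · congr! 1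
        linear_combination (-a * u * 𝔪 * 𝔫') * hdet'
  have hmap : !![1, polyToK Fq a; 0, 1] = (!![1, a; 0, 1]).map (polyToK Fq) := by
    refine Matrix.ext fun i j => ?_
    fin_cases i <;> fin_cases j <;> simp
  rw [hmap, ← Matrix.mul_assoc, ← Matrix.map_mul, hmul, Matrix.map_mul, Matrix.mul_assoc]
  have hW : ((!![s * 𝔪, t; u * (𝔪 * 𝔫'), v * 𝔪]).map (polyToK Fq) * g).det ≠ 0 := by
    rw [Matrix.det_mul, det_atkinLehner hdet]
    exact mul_ne_zero (polyToK_ne_zero h𝔪) hg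
  simpa using hf.1 _ hW γ hγ 1 one_ne_zero 1 inIw_one

/-- Cuspidality handles the Atkin–Lehner transforms not covered by the hypothesis of the
vanishing criterion. -/
theorem atkinLehner_edge_eq_zero (hf : Harmonic Fq 𝔫 f) (hcusp : Cuspidal Fq 𝔫 f)
    (h𝔪 : 𝔪 ≠ 0) (hdvd : 𝔪 ∣ 𝔫) (hdet : s * v * 𝔪 ^ 2 - u * t * 𝔫 = 𝔪) {k : ℤ} (hk : k ≤ 1)
    (w : Kinf Fq) :
    f ((!![s * 𝔪, t; u * 𝔫, v * 𝔪]).map (polyToK Fq) * edge k w) = 0 := by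
  have hW : ((!![s * 𝔪, t; u * 𝔫, v * 𝔪]).map (polyToK Fq)).det ≠ 0 := by
    rw [det_atkinLehner hdet]; exact polyToK_ne_zero h𝔪
  refine (hf.rightHarmonic hW).edge_eq_zero_of_finite
    (fun a g hg => hf.atkinLehner_translate h𝔪 hdvd hdet a hg) ?_ k hk w
  refine (hcusp.finite_values hf).subset ?_
  rintro _ ⟨g, hg, rfl⟩
  exact ⟨_, by rw [Set.mem_ofPred_eq, Matrix.det_mul]; exact mul_ne_zero hW hg, rfl⟩

/-- If all Atkin–Lehner transforms vanish on the horoballs `k ≤ deg 𝔫 - deg 𝔪` at infinity, then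
the cochain vanishes on every edge `(π_∞^k, w; 0, 1)`. -/
theorem Harmonic.edge_eq_zero (hf : Harmonic Fq 𝔫 f) (h𝔫 : 𝔫.Monic) (hsf : Squarefree 𝔫)
    (h : ∀ 𝔪 : Polynomial Fq, 𝔪.Monic → 𝔪 ∣ 𝔫 →
      ∀ s t u v : Polynomial Fq, s * v * 𝔪 ^ 2 - u * t * 𝔫 = 𝔪 →
      ∀ k : ℤ, k ≤ 𝔫.natDegree - 𝔪.natDegree → ∀ w : Kinf Fq,
        f ((!![s * 𝔪, t; u * 𝔫, v * 𝔪]).map (polyToK Fq) * edge k w) = 0)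
    (k : ℤ) (w : Kinf Fq) : f (edge k w) = 0 := by
  obtain ⟨c₀, a₀, hdvd, hne, α, β, hα, hβ, hkα, hkβ⟩ := exists_short_vector h𝔫 k w
  obtain ⟨d, c, a, hd, hca, rfl, rfl⟩ : ∃ d c a : Polynomial Fq, d ≠ 0 ∧ IsCoprime c a ∧
      c₀ = d * c ∧ a₀ = d * a := by
    classical
    have hd : EuclideanDomain.gcd c₀ a₀ ≠ 0 := fun h => by
      have := EuclideanDomain.gcd_eq_zero_iff.mp h
      tauto
    obtain ⟨c, hc⟩ := EuclideanDomain.gcd_dvd_left c₀ a₀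
    obtain ⟨a, ha⟩ := EuclideanDomain.gcd_dvd_right c₀ a₀
    refine ⟨_, c, a, hd, ?_, hc, ha⟩
    refine ⟨EuclideanDomain.gcdA c₀ a₀, EuclideanDomain.gcdB c₀ a₀, mul_left_cancel₀ hd ?_⟩
    have := EuclideanDomain.gcd_eq_gcd_ab c₀ a₀
    linear_combination -this - EuclideanDomain.gcdA c₀ a₀ * hc - EuclideanDomain.gcdB c₀ a₀ * ha
  obtain ⟨𝔪, 𝔫', s, t, u, v, h𝔪, hmn, hmc, hdet, hc, rfl⟩ := exists_atkinLehner h𝔫 hsf hca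
  have hmdvd : 𝔪 ∣ 𝔫 := ⟨𝔫', by rw [hmn, mul_comm]⟩
  have hmd : 𝔪 ∣ d := hmc.dvd_of_dvd_mul_right (hmdvd.trans hdvd)
  have hdeg : 𝔪.natDegree ≤ d.natDegree := Polynomial.natDegree_le_of_dvd hmd hd
  have hm0 : polyToK Fq 𝔪 ≠ 0 := polyToK_ne_zero h𝔪.ne_zero
  have hW : ((!![a * 𝔪, t; u * 𝔫, v * 𝔪]).map (polyToK Fq)).det ≠ 0 := by
    rwa [det_atkinLehner hdet]
  set V : Matrix (Fin 2) (Fin 2) (Kinf Fq) :=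
    (!![v * 𝔪, -t; -(u * 𝔫), a * 𝔪]).map (polyToK Fq) with hV
  have hWV : (!![a * 𝔪, t; u * 𝔫, v * 𝔪]).map (polyToK Fq) * (V * edge k w) =
      polyToK Fq 𝔪 • edge k w := by
    have h1 : (!![a * 𝔪, t; u * 𝔫, v * 𝔪]) * !![v * 𝔪, -t; -(u * 𝔫), a * 𝔪] =
        𝔪 • (1 : Matrix (Fin 2) (Fin 2) (Polynomial Fq)) := by
      refine Matrix.ext fun i j => ?_
      fin_cases i <;> fin_cases j <;> simp
      · linear_combination hdet
      · ring
      · ring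
      · linear_combination hdet
    rw [← Matrix.mul_assoc, hV, ← Matrix.map_mul, h1]
    refine Matrix.ext fun i j => ?_
    fin_cases i <;> fin_cases j <;> simp [edge, Matrix.mul_apply, Fin.sum_univ_two]
  have hVdet : (V * edge k w).det = polyToK Fq 𝔪 * piInf Fq ^ k := by
    rw [Matrix.det_mul, det_edge, hV, det_map_polyToK, Matrix.det_fin_two_of]
    congr 2
    linear_combination hdet
  have hπ : piInf Fq ^ k ≠ 0 := zpow_ne_zero _ piInf_ne_zero
  have hVord : (V * edge k w).det.order = -(𝔪.natDegree : ℤ) + k := by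
    rw [hVdet, HahnSeries.order_mul hm0 hπ, order_polyToK h𝔪.ne_zero, order_piInf_zpow]
  have hdK : polyToK Fq d ≠ 0 := polyToK_ne_zero hd
  have hmV : VGe (-(𝔪.natDegree : ℤ)) (polyToK Fq 𝔪) :=
    (vGe_iff_le_order hm0).mpr (order_polyToK h𝔪.ne_zero).ge
  have hentry : -(u * 𝔫) = 𝔪 * c := by rw [hc, hmn]; ring
  have hscale : ∀ {γ : ℤ} {x y : Kinf Fq}, polyToK Fq d * x = polyToK Fq 𝔪 * y → VGe γ y →
      VGe (γ - 𝔪.natDegree + d.natDegree) x := by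
    intro γ x y hxy hy
    apply vGe_of_mul hdK (order_polyToK hd).le
    rw [hxy]
    exact (hmV.mul hy).mono (by omega)
  have hb : VGe (α - 𝔪.natDegree + d.natDegree) ((V * edge k w) 1 0) := by
    refine hscale ?_ hα
    rw [hV, hentry]
    simp [edge, Matrix.mul_apply, Fin.sum_univ_two]
    ring
  have ha : VGe (β - 𝔪.natDegree + d.natDegree) ((V * edge k w) 1 1) := by
    refine hscale ?_ hβ
    rw [hV, hentry]
    simp [edge, Matrix.mul_apply, Fin.sum_univ_two]
    ring
  have hvan := (hf.rightHarmonic hW).eq_zero_of_vGe (h 𝔪 h𝔪 hmdvd a t u v hdet)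
    (by rw [hVdet]; exact mul_ne_zero hm0 hπ) ha hb (by omega) (by omega)
  rwa [hWV, hf.rightHarmonic_self.smul (det_edge_ne_zero k w) hm0] at hvan

end AtkinLehner

/-- **Atkin–Lehner vanishing criterion in square-free level**: if `𝔫` is square-free,
`f ∈ H₀(𝔫)`, and all Atkin–Lehner transforms `f|W_𝔪`, for monic `𝔪 ∣ 𝔫` with
`deg 𝔪 ≤ deg 𝔫 − 2`, vanish on the edges `(π_∞^{deg 𝔫 − deg 𝔪}, w; 0, 1)·e₀`, then
`f` is identically zero. -/
theorem atkin_lehner_vanishing_squarefree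
    (Fq : Type) [Field Fq] [Fintype Fq]
    (𝔫 : Polynomial Fq) (h𝔫 : 𝔫.Monic) (hsf : Squarefree 𝔫)
    (f : Matrix (Fin 2) (Fin 2) (Kinf Fq) → ℂ)
    (hf : Harmonic Fq 𝔫 f) (hcusp : Cuspidal Fq 𝔫 f)
    (h : ∀ 𝔪 : Polynomial Fq, 𝔪.Monic → 𝔪 ∣ 𝔫 →
      (𝔪.natDegree : ℤ) ≤ (𝔫.natDegree : ℤ) - 2 →
      ∀ s t u v : Polynomial Fq, s * v * 𝔪 ^ 2 - u * t * 𝔫 = 𝔪 →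
      ∀ w : Kinf Fq,
        f ((!![s * 𝔪, t; u * 𝔫, v * 𝔪]).map (polyToK Fq) *
            !![piInf Fq ^ (𝔫.natDegree - 𝔪.natDegree), w; 0, 1]) = 0) :
    ∀ g : Matrix (Fin 2) (Fin 2) (Kinf Fq), g.det ≠ 0 → f g = 0 := by
  intro g hg
  refine hf.rightHarmonic_self.eq_zero_of_edge
    (hf.edge_eq_zero h𝔫 hsf fun 𝔪 h𝔪 hdvd s t u v hdet => ?_) hg
  by_cases hdeg : (𝔪.natDegree : ℤ) ≤ (𝔫.natDegree : ℤ) - 2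
  · have hW : ((!![s * 𝔪, t; u * 𝔫, v * 𝔪]).map (polyToK Fq)).det ≠ 0 := by
      rw [det_atkinLehner hdet]; exact polyToK_ne_zero h𝔪.ne_zero
    refine (hf.rightHarmonic hW).edge_eq_zero_of_le fun w => ?_
    have hpow : piInf Fq ^ ((𝔫.natDegree : ℤ) - 𝔪.natDegree) =
        piInf Fq ^ (𝔫.natDegree - 𝔪.natDegree) := by
      rw [← zpow_natCast, Nat.cast_sub (by omega)]
    simpa only [edge, hpow] using h 𝔪 h𝔪 hdvd hdeg s t u v hdet w
  · exact fun k hk w => atkinLehner_edge_eq_zero hf hcusp h𝔪.ne_zero hdvd hdet (by omega) w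
end SturmFF
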